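/- Let μ_n = E[S^C(2,n)] and σ_n = √(Var[S^C(2,n)]) be the mean and standard deviation of the number of Column actions surviving iterated elimination in G(2,n). There exists a constant K > 0 such that for all n ≥ 2 and all real x, |Pr(S^C(2,n) − μ_n ≤ x·σ_n) − Φ(x)| ≤ K/√(ln n), where Φ is the standard normal distribution function. Moreover, μ_n = ln n + γ + o(1), and σ_n = √(ln n) − (π² − 6γ)/(12·√(ln n)) + o(1/√(ln n)) as n → ∞, where γ is the Euler–Mascheroni constant. -/

import Mathlib

open Finset Filter

noncomputable section

/-- Row action `i` is strictly dominated in the restricted game with Row actions `X`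
and Column actions `Y`, for Row payoff matrix `R`. -/
def RowDomIn {m n : ℕ} (R : Fin m → Fin n → ℝ) (X : Finset (Fin m)) (Y : Finset (Fin n))
    (i : Fin m) : Prop :=
  ∃ i' ∈ X, ∀ j ∈ Y, R i j < R i' j

/-- Column action `j` is strictly dominated in the restricted game with Row actions `X`
and Column actions `Y`, for Column payoff matrix `C`. -/
def ColDomIn {m n : ℕ} (C : Fin m → Fin n → ℝ) (X : Finset (Fin m)) (Y : Finset (Fin n))
    (j : Fin n) : Prop :=
  ∃ j' ∈ Y, ∀ i ∈ X, C i j < C i j'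

open Classical in
/-- One round of iterated elimination: simultaneously delete every strictly dominated
action of both players in the current restricted game. -/
def elimStep {m n : ℕ} (R C : Fin m → Fin n → ℝ)
    (p : Finset (Fin m) × Finset (Fin n)) : Finset (Fin m) × Finset (Fin n) :=
  (p.1.filter fun i => ¬ RowDomIn R p.1 p.2 i,
   p.2.filter fun j => ¬ ColDomIn C p.1 p.2 j)

/-- Surviving actions of the subgame `(p.1, p.2)` after iterated elimination of strictly
dominated actions (iterating `m + n` times surely reaches the fixed point). -/
def survivorsFrom {m n : ℕ} (R C : Fin m → Fin n → ℝ)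
    (p : Finset (Fin m) × Finset (Fin n)) : Finset (Fin m) × Finset (Fin n) :=
  (elimStep R C)^[m + n] p

/-- The subgame `(p.1, p.2)` is strict-dominance solvable: exactly one action of each
player survives iterated elimination of strictly dominated actions. -/
def SolvableFrom {m n : ℕ} (R C : Fin m → Fin n → ℝ)
    (p : Finset (Fin m) × Finset (Fin n)) : Prop :=
  (survivorsFrom R C p).1.card = 1 ∧ (survivorsFrom R C p).2.card = 1

/-- Surviving actions of the full game after iterated elimination. -/
def survivors {m n : ℕ} (R C : Fin m → Fin n → ℝ) : Finset (Fin m) × Finset (Fin n) :=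
  survivorsFrom R C (Finset.univ, Finset.univ)

/-- The game is strict-dominance solvable. -/
def Solvable {m n : ℕ} (R C : Fin m → Fin n → ℝ) : Prop :=
  SolvableFrom R C (Finset.univ, Finset.univ)

/-- The number of rounds performed by the iterated elimination procedure:
the least `k` such that round `k + 1` deletes nothing more. -/
def elimRounds {m n : ℕ} (R C : Fin m → Fin n → ℝ) : ℕ :=
  sInf {k | (elimStep R C)^[k + 1] (Finset.univ, Finset.univ)
          = (elimStep R C)^[k] (Finset.univ, Finset.univ)}

/-- Sample space of the random game `G(m,n)`: for each Column action an i.i.d. uniform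
permutation giving Row's ordinal payoffs in that column, and for each Row action an
i.i.d. uniform permutation giving Column's ordinal payoffs in that row. -/
abbrev Omega (m n : ℕ) := (Fin n → Equiv.Perm (Fin m)) × (Fin m → Equiv.Perm (Fin n))

/-- Row's payoff matrix of the realized game. -/
def RPay {m n : ℕ} (ω : Omega m n) : Fin m → Fin n → ℝ := fun i j => ((ω.1 j) i : ℕ)

/-- Column's payoff matrix of the realized game. -/
def CPay {m n : ℕ} (ω : Omega m n) : Fin m → Fin n → ℝ := fun i j => ((ω.2 i) j : ℕ)

/-- Probability of an event under the uniform distribution on `Omega m n`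
(i.e. all `m + n` permutations uniform and mutually independent). -/
def Pr {m n : ℕ} (E : Set (Omega m n)) : ℝ :=
  (E.toFinite.toFinset.card : ℝ) / (Fintype.card (Omega m n) : ℝ)

open Classical in
/-- Number of Row actions that are not strictly dominated. -/
def UR {m n : ℕ} (ω : Omega m n) : ℕ :=
  (Finset.univ.filter fun i => ¬ RowDomIn (RPay ω) Finset.univ Finset.univ i).card

open Classical in
/-- Number of Column actions that are not strictly dominated. -/
def UC {m n : ℕ} (ω : Omega m n) : ℕ :=
  (Finset.univ.filter fun j => ¬ ColDomIn (CPay ω) Finset.univ Finset.univ j).card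

/-- Number of Row actions surviving iterated elimination. -/
def SR {m n : ℕ} (ω : Omega m n) : ℕ := (survivors (RPay ω) (CPay ω)).1.card

/-- Number of Column actions surviving iterated elimination. -/
def SC {m n : ℕ} (ω : Omega m n) : ℕ := (survivors (RPay ω) (CPay ω)).2.card

/-- The realized game is strict-dominance solvable. -/
def GameSolvable {m n : ℕ} (ω : Omega m n) : Prop := Solvable (RPay ω) (CPay ω)

/-- Number of rounds of the iterated elimination procedure in the realized game. -/
def GameRounds {m n : ℕ} (ω : Omega m n) : ℕ := elimRounds (RPay ω) (CPay ω)

/-- `π(m,n)`: probability that the random game `G(m,n)` is strict-dominance solvable. -/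
def probSolvable (m n : ℕ) : ℝ := Pr {ω : Omega m n | GameSolvable ω}

/-- Expected number of Column's strictly undominated actions, `E[U^C(m,n)]`. -/
def expUC (m n : ℕ) : ℝ :=
  (∑ ω : Omega m n, (UC ω : ℝ)) / (Fintype.card (Omega m n) : ℝ)

/-- Expected number of Column actions surviving iterated elimination, `E[S^C(m,n)]`. -/
def expSC (m n : ℕ) : ℝ :=
  (∑ ω : Omega m n, (SC ω : ℝ)) / (Fintype.card (Omega m n) : ℝ)

open Classical in
/-- `E[I(m,n)]`: expected number of elimination rounds conditional on the game being
strict-dominance solvable. -/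
def condExpRounds (m n : ℕ) : ℝ :=
  (∑ ω : Omega m n, if GameSolvable ω then (GameRounds ω : ℝ) else 0) /
    (∑ ω : Omega m n, if GameSolvable ω then (1 : ℝ) else 0)

/-- Unsigned Stirling numbers of the first kind. -/
def stirling1 : ℕ → ℕ → ℕ
  | 0, 0 => 1
  | 0, _ + 1 => 0
  | _ + 1, 0 => 0
  | n + 1, k + 1 => n * stirling1 n (k + 1) + stirling1 n k

end

/-- Mean of the number of Column actions surviving iterated elimination in `G(2,n)`. -/
noncomputable def muSC (n : ℕ) : ℝ := expSC 2 n

/-- Variance of the number of Column actions surviving iterated elimination in `G(2,n)`. -/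
noncomputable def varSC (n : ℕ) : ℝ :=
  (∑ ω : Omega 2 n, ((SC ω : ℝ) - muSC n) ^ 2) / (Fintype.card (Omega 2 n) : ℝ)

/-- Standard deviation of the number of surviving Column actions in `G(2,n)`. -/
noncomputable def sigmaSC (n : ℕ) : ℝ := Real.sqrt (varSC n)

/-- Cumulative distribution function of the standard normal distribution. -/
noncomputable def stdNormalCDF (x : ℝ) : ℝ :=
  (∫ t in Set.Iic x, Real.exp (-t ^ 2 / 2)) / Real.sqrt (2 * Real.pi)

/-- Expectation of `g` applied to the number of successes among independent Bernoulli trials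
indexed by `s`, trial `i` having success probability `p i`. -/
noncomputable def bernoulliSumExp (p : ℕ → ℝ) (s : Finset ℕ) (g : ℕ → ℝ) : ℝ :=
  ∑ A ∈ s.powerset, (∏ i ∈ A, p i) * (∏ i ∈ s \ A, (1 - p i)) * g A.card

namespace bernoulliSumExp

variable {p : ℕ → ℝ} {s : Finset ℕ}

theorem empty (p : ℕ → ℝ) (g : ℕ → ℝ) : bernoulliSumExp p ∅ g = g 0 := by
  simp [bernoulliSumExp]

theorem insert_eq {a : ℕ} (ha : a ∉ s) (g : ℕ → ℝ) :
    bernoulliSumExp p (insert a s) g =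
      p a * bernoulliSumExp p s (fun k => g (k + 1)) + (1 - p a) * bernoulliSumExp p s g := by
  unfold bernoulliSumExp
  rw [Finset.sum_powerset_insert ha, add_comm, Finset.mul_sum, Finset.mul_sum]
  congr 1
  · refine Finset.sum_congr rfl fun A hA => ?_
    have hAs := Finset.mem_powerset.1 hA
    have haA : a ∉ A := fun h => ha (hAs h)
    have : insert a s \ insert a A = s \ A := by
      ext x; simp only [Finset.mem_sdiff, Finset.mem_insert]
      constructor
      · rintro ⟨h1 | h1, h2⟩ <;> tauto
      · rintro ⟨h1, h2⟩
        refine ⟨Or.inr h1, ?_⟩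
        rintro (rfl | h) <;> tauto
    rw [Finset.prod_insert haA, this, Finset.card_insert_of_notMem haA]
    ring
  · refine Finset.sum_congr rfl fun A hA => ?_
    have hAs := Finset.mem_powerset.1 hA
    have haA : a ∉ A := fun h => ha (hAs h)
    rw [Finset.insert_sdiff_of_notMem _ haA, Finset.prod_insert (by simp [ha])]
    ring

theorem eq_erase {a : ℕ} (ha : a ∈ s) (g : ℕ → ℝ) :
    bernoulliSumExp p s g = p a * bernoulliSumExp p (s.erase a) (fun k => g (k + 1)) +
      (1 - p a) * bernoulliSumExp p (s.erase a) g := by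
  conv_lhs => rw [← Finset.insert_erase ha]
  exact insert_eq (Finset.notMem_erase a s) g

theorem add (g h : ℕ → ℝ) : bernoulliSumExp p s (fun k => g k + h k) =
    bernoulliSumExp p s g + bernoulliSumExp p s h := by
  simp only [bernoulliSumExp, mul_add, Finset.sum_add_distrib]

theorem const_mul (c : ℝ) (g : ℕ → ℝ) : bernoulliSumExp p s (fun k => c * g k) =
    c * bernoulliSumExp p s g := by
  simp only [bernoulliSumExp, Finset.mul_sum]
  exact Finset.sum_congr rfl fun _ _ => by ring

theorem sub (g h : ℕ → ℝ) : bernoulliSumExp p s (fun k => g k - h k) =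
    bernoulliSumExp p s g - bernoulliSumExp p s h := by
  simp only [bernoulliSumExp, mul_sub, Finset.sum_sub_distrib]

theorem const (c : ℝ) : bernoulliSumExp p s (fun _ => c) = c := by
  induction s using Finset.induction_on with
  | empty => exact empty p _
  | insert a s ha ih => rw [insert_eq ha, ih]; ring

theorem mono (hp : ∀ i, 0 ≤ p i ∧ p i ≤ 1) {g h : ℕ → ℝ} (hgh : ∀ k, g k ≤ h k) :
    bernoulliSumExp p s g ≤ bernoulliSumExp p s h := by
  refine Finset.sum_le_sum fun A _ => mul_le_mul_of_nonneg_left (hgh _) ?_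
  exact mul_nonneg (Finset.prod_nonneg fun i _ => (hp i).1)
    (Finset.prod_nonneg fun i _ => by linarith [(hp i).2])

theorem abs_le (hp : ∀ i, 0 ≤ p i ∧ p i ≤ 1) {g h : ℕ → ℝ} (hgh : ∀ k, |g k| ≤ h k) :
    |bernoulliSumExp p s g| ≤ bernoulliSumExp p s h := by
  rw [_root_.abs_le]
  constructor
  · have := mono (p := p) (s := s) hp (g := fun k => -1 * h k) (h := g)
      fun k => by linarith [neg_abs_le (g k), hgh k]
    rw [const_mul] at this
    linarith
  · exact mono hp fun k => (le_abs_self _).trans (hgh k)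

theorem pow (t : ℝ) : bernoulliSumExp p s (fun k => t ^ k) = ∏ i ∈ s, (1 - (1 - t) * p i) := by
  induction s using Finset.induction_on with
  | empty => simp [empty]
  | insert a s ha ih =>
    rw [insert_eq ha, Finset.prod_insert ha, ← ih]
    simp only [pow_succ']
    rw [const_mul]
    ring

/-- Stein identity for a sum of independent Bernoulli variables. -/
theorem stein_identity (g : ℕ → ℝ) :
    bernoulliSumExp p s (fun k => ((k : ℝ) - ∑ i ∈ s, p i) * g k) =
      ∑ i ∈ s, p i * (1 - p i) * bernoulliSumExp p (s.erase i) (fun k => g (k + 1) - g k) := by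
  induction s using Finset.induction_on generalizing g with
  | empty => simp [empty]
  | insert a s ha ih =>
    rw [insert_eq ha, Finset.sum_insert ha, Finset.sum_insert ha, Finset.erase_insert ha]
    have h1 : (fun k : ℕ => (((k + 1 : ℕ) : ℝ) - (p a + ∑ i ∈ s, p i)) * g (k + 1)) =
        fun k : ℕ => ((k : ℝ) - ∑ i ∈ s, p i) * g (k + 1) + (1 - p a) * g (k + 1) := by
      funext k; push_cast; ring
    have h2 : (fun k : ℕ => ((k : ℝ) - (p a + ∑ i ∈ s, p i)) * g k) =
        fun k : ℕ => ((k : ℝ) - ∑ i ∈ s, p i) * g k - p a * g k := by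
      funext k; ring
    rw [h1, h2, add, sub, const_mul, const_mul, ih (fun k => g (k + 1)), ih g]
    have h3 : ∑ i ∈ s, p i * (1 - p i) *
        bernoulliSumExp p ((insert a s).erase i) (fun k => g (k + 1) - g k) =
        p a * (∑ i ∈ s, p i * (1 - p i) *
          bernoulliSumExp p (s.erase i) (fun k => g (k + 1 + 1) - g (k + 1))) +
        (1 - p a) * ∑ i ∈ s, p i * (1 - p i) *
          bernoulliSumExp p (s.erase i) (fun k => g (k + 1) - g k) := by
      rw [Finset.mul_sum, Finset.mul_sum, ← Finset.sum_add_distrib]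
      refine Finset.sum_congr rfl fun i hi => ?_
      have hia : a ≠ i := fun h => ha (h ▸ hi)
      rw [Finset.erase_insert_of_ne hia, insert_eq (by simp [ha])]
      ring
    rw [h3, sub (fun k => g (k + 1))]
    ring

theorem mean : bernoulliSumExp p s (fun k => (k : ℝ)) = ∑ i ∈ s, p i := by
  have := stein_identity (p := p) (s := s) (fun _ => 1)
  simp only [mul_one, sub_self, const, mul_zero, Finset.sum_const_zero] at this
  rw [sub, const] at this
  linarith

theorem variance : bernoulliSumExp p s (fun k => ((k : ℝ) - ∑ i ∈ s, p i) ^ 2) =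
    ∑ i ∈ s, p i * (1 - p i) := by
  have := stein_identity (p := p) (s := s) (fun k => (k : ℝ) - ∑ i ∈ s, p i)
  have h : (fun k : ℕ => ((k + 1 : ℕ) : ℝ) - ∑ i ∈ s, p i - ((k : ℝ) - ∑ i ∈ s, p i)) =
      fun _ => 1 := by
    funext k; push_cast; ring
  simp only [h, const, mul_one] at this
  simpa only [sq] using this

theorem abs_sub_mean_le (hp : ∀ i, 0 ≤ p i ∧ p i ≤ 1) {σ : ℝ} (hσ : 0 < σ)
    (hσ2 : ∑ i ∈ s, p i * (1 - p i) = σ ^ 2) :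
    bernoulliSumExp p s (fun k => |(k : ℝ) - ∑ i ∈ s, p i|) ≤ σ := by
  have h : ∀ k : ℕ, |(k : ℝ) - ∑ i ∈ s, p i| ≤
      (1 / (2 * σ)) * ((k : ℝ) - ∑ i ∈ s, p i) ^ 2 + σ / 2 := by
    intro k
    set y := (k : ℝ) - ∑ i ∈ s, p i
    rw [← sub_nonneg]
    have : 1 / (2 * σ) * y ^ 2 + σ / 2 - |y| = (|y| - σ) ^ 2 / (2 * σ) := by
      rw [← sq_abs y]; field_simp; ring
    rw [this]; positivity
  refine (mono hp h).trans (le_of_eq ?_)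
  rw [add, const_mul, variance, const, hσ2]
  field_simp; ring

/-- Concentration: the sum lies within distance one of a given real with probability at most
`2 / σ`. -/
theorem concentration (hp : ∀ i, 0 ≤ p i ∧ p i ≤ 1) {σ : ℝ} (hσ : 0 < σ)
    (hσ2 : ∑ i ∈ s, p i * (1 - p i) = σ ^ 2) (y : ℝ) :
    bernoulliSumExp p s (fun k => if |(k : ℝ) - y| ≤ 1 then 1 else 0) ≤ 2 / σ := by
  set q : ℕ → ℝ := fun k => if |(k : ℝ) - y| ≤ 1 then 1 else 0 with hq
  set g : ℕ → ℝ := fun k => max (-2) (min 2 ((k : ℝ) - y)) with hg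
  have hle : ∀ k, g k ≤ g (k + 1) := by
    intro k
    simp only [hg]
    gcongr
    simp
  have hstep : ∀ k, q k ≤ g (k + 1) - g k ∧ q (k + 1) ≤ g (k + 1) - g k := by
    intro k
    have h0 := hle k
    have key : -2 ≤ (k : ℝ) - y → (k : ℝ) + 1 - y ≤ 2 → g (k + 1) - g k = 1 := by
      intro h1 h2
      simp only [hg, Nat.cast_add, Nat.cast_one]
      rw [min_eq_right h2, min_eq_right (by linarith), max_eq_right (by linarith),
        max_eq_right h1]
      ring
    constructor
    · simp only [hq]
      split_ifs with h
      · rw [_root_.abs_le] at h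
        rw [key (by linarith) (by linarith)]
      · linarith
    · simp only [hq]
      split_ifs with h
      · rw [_root_.abs_le] at h
        push_cast at h
        rw [key (by linarith) (by linarith)]
      · linarith
  have h1 : σ ^ 2 * bernoulliSumExp p s q ≤
      bernoulliSumExp p s (fun k => ((k : ℝ) - ∑ i ∈ s, p i) * g k) := by
    rw [stein_identity, ← hσ2, Finset.sum_mul]
    refine Finset.sum_le_sum fun i hi => mul_le_mul_of_nonneg_left ?_
      (mul_nonneg (hp i).1 (by linarith [(hp i).2]))
    rw [eq_erase hi]
    have a1 := mono (s := s.erase i) hp fun k => (hstep k).1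
    have a2 := mono (s := s.erase i) hp fun k => (hstep k).2
    nlinarith [(hp i).1, (hp i).2]
  have h2 : bernoulliSumExp p s (fun k => ((k : ℝ) - ∑ i ∈ s, p i) * g k) ≤ 2 * σ := by
    calc _ ≤ bernoulliSumExp p s (fun k => 2 * |(k : ℝ) - ∑ i ∈ s, p i|) := by
          refine mono hp fun k => ?_
          have : |g k| ≤ 2 := by
            rw [_root_.abs_le]
            exact ⟨le_max_left _ _, max_le (by norm_num) (min_le_left _ _)⟩
          refine (le_abs_self _).trans ?_
          rw [abs_mul, mul_comm]
          exact mul_le_mul_of_nonneg_right this (abs_nonneg _)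
      _ ≤ _ := by
          rw [const_mul]
          exact mul_le_mul_of_nonneg_left (abs_sub_mean_le hp hσ hσ2) (by norm_num)
  rw [le_div_iff₀ hσ]
  nlinarith

end bernoulliSumExp

namespace SteinGaussian

open Real MeasureTheory

/-- Unnormalised Gaussian distribution function. -/
noncomputable def gaussInt (x : ℝ) : ℝ := ∫ t in Set.Iic x, exp (-t ^ 2 / 2)

theorem integrable_exp_neg_sq_div_two : Integrable fun t : ℝ => exp (-t ^ 2 / 2) := by
  have := integrable_exp_neg_mul_sq (b := 1 / 2) (by norm_num)
  refine this.congr (Filter.Eventually.of_forall fun t => ?_)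
  simp only
  congr 1; ring

theorem integral_exp_neg_sq_div_two : ∫ t : ℝ, exp (-t ^ 2 / 2) = √(2 * π) := by
  have := integral_gaussian (1 / 2)
  rw [show √(2 * π) = √(π / (1 / 2)) by congr 1; ring, ← this]
  congr 1; funext t; congr 1; ring

theorem gaussInt_add_gaussInt_neg (x : ℝ) : gaussInt x + gaussInt (-x) = √(2 * π) := by
  have h : gaussInt (-x) = ∫ t in Set.Ioi x, exp (-t ^ 2 / 2) := by
    unfold gaussInt
    rw [← integral_comp_neg_Ioi]
    simp
  rw [h, ← integral_exp_neg_sq_div_two]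
  unfold gaussInt
  rw [← Set.compl_Iic]
  exact integral_add_compl measurableSet_Iic integrable_exp_neg_sq_div_two

theorem hasDerivAt_gaussInt (x : ℝ) : HasDerivAt gaussInt (exp (-x ^ 2 / 2)) x := by
  have h : gaussInt = fun y => gaussInt 0 + ∫ t in (0 : ℝ)..y, exp (-t ^ 2 / 2) := by
    funext y
    have := intervalIntegral.integral_Iic_sub_Iic (f := fun t : ℝ => exp (-t ^ 2 / 2)) (a := 0)
      (b := y) (μ := volume) integrable_exp_neg_sq_div_two.integrableOn
      integrable_exp_neg_sq_div_two.integrableOn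
    rw [← this]
    unfold gaussInt
    ring
  rw [h]
  have hc : Continuous fun t : ℝ => exp (-t ^ 2 / 2) := by fun_prop
  exact (intervalIntegral.integral_hasDerivAt_right (hc.intervalIntegrable _ _)
    hc.stronglyMeasurable.stronglyMeasurableAtFilter hc.continuousAt).const_add _

theorem gaussInt_nonneg (x : ℝ) : 0 ≤ gaussInt x :=
  integral_nonneg fun _ => (exp_pos _).le

theorem exp_add_mul_gaussInt_nonneg (w : ℝ) : 0 ≤ exp (-w ^ 2 / 2) + w * gaussInt w := by
  have hd : ∀ t : ℝ, HasDerivAt (fun t : ℝ => exp (-t ^ 2 / 2)) (-t * exp (-t ^ 2 / 2)) t := by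
    intro t
    have := ((hasDerivAt_pow 2 t).fun_neg.div_const 2).exp
    exact this.congr_deriv (by simp; ring)
  have hi : Integrable fun t : ℝ => -t * exp (-t ^ 2 / 2) := by
    have := integrable_mul_exp_neg_mul_sq (b := 1 / 2) (by norm_num)
    refine this.neg.congr (Filter.Eventually.of_forall fun t => ?_)
    simp only [Pi.neg_apply]
    rw [show -(1 / 2) * t ^ 2 = -t ^ 2 / 2 by ring, neg_mul]
  have ht : Filter.Tendsto (fun t : ℝ => exp (-t ^ 2 / 2)) Filter.atBot (nhds 0) := by
    refine tendsto_exp_atBot.comp ?_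
    have h2 : Filter.Tendsto (fun t : ℝ => t ^ 2) Filter.atBot Filter.atTop := by
      simpa [sq] using Filter.tendsto_id.atBot_mul_atBot₀ (Filter.tendsto_id (α := ℝ))
    have := (Filter.tendsto_neg_atTop_atBot.comp h2).atBot_div_const (r := 2) (by norm_num)
    exact this
  have h := integral_Iic_of_hasDerivAt_of_tendsto' (a := w) (fun t _ => hd t) hi.integrableOn ht
  have h2 : exp (-w ^ 2 / 2) + w * gaussInt w =
      ∫ t in Set.Iic w, (w - t) * exp (-t ^ 2 / 2) := by
    rw [sub_zero] at h
    unfold gaussInt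
    rw [← h, ← integral_const_mul, ← integral_add hi.integrableOn
      (integrable_exp_neg_sq_div_two.const_mul w).integrableOn]
    congr 1; funext t; ring
  rw [h2]
  refine setIntegral_nonneg measurableSet_Iic fun t ht => mul_nonneg ?_ (exp_pos _).le
  exact sub_nonneg.2 ht

theorem stdNormalCDF_eq (x : ℝ) : stdNormalCDF x = gaussInt x / √(2 * π) := rfl

theorem sqrt_two_pi_pos : 0 < √(2 * π) := by positivity

theorem stdNormalCDF_neg (x : ℝ) : stdNormalCDF (-x) = 1 - stdNormalCDF x := by
  have := gaussInt_add_gaussInt_neg x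
  have h := sqrt_two_pi_pos
  rw [stdNormalCDF_eq, stdNormalCDF_eq, eq_sub_iff_add_eq, ← add_div, add_comm, this,
    div_self h.ne']

theorem stdNormalCDF_nonneg (x : ℝ) : 0 ≤ stdNormalCDF x :=
  div_nonneg (gaussInt_nonneg x) sqrt_two_pi_pos.le

theorem stdNormalCDF_le_one (x : ℝ) : stdNormalCDF x ≤ 1 := by
  have := stdNormalCDF_nonneg (-x)
  rw [stdNormalCDF_neg] at this
  linarith

theorem hasDerivAt_stdNormalCDF (x : ℝ) :
    HasDerivAt stdNormalCDF (exp (-x ^ 2 / 2) / √(2 * π)) x :=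
  (hasDerivAt_gaussInt x).div_const _

theorem stdNormalCDF_mono : Monotone stdNormalCDF :=
  monotone_of_deriv_nonneg (fun x => (hasDerivAt_stdNormalCDF x).differentiableAt) fun x => by
    rw [(hasDerivAt_stdNormalCDF x).deriv]; positivity

theorem one_le_sqrt_two_pi : 1 ≤ √(2 * π) := by
  rw [one_le_sqrt]; nlinarith [pi_gt_three]

theorem sqrt_two_pi_le_four : √(2 * π) ≤ 4 := by
  rw [sqrt_le_left (by norm_num)]; nlinarith [pi_le_four]

theorem abs_stdNormalCDF_sub_le (x y : ℝ) : |stdNormalCDF x - stdNormalCDF y| ≤ |x - y| := by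
  have := Convex.norm_image_sub_le_of_norm_hasDerivWithin_le (f := stdNormalCDF) (s := Set.univ)
    (C := 1) (x := y) (y := x)
    (fun z _ => (hasDerivAt_stdNormalCDF z).hasDerivWithinAt) (fun z _ => ?_) convex_univ
    trivial trivial
  · simpa using this
  · rw [norm_of_nonneg (by positivity)]
    refine div_le_one_of_le₀ (le_trans ?_ one_le_sqrt_two_pi) (by positivity)
    exact exp_le_one_iff.2 (by nlinarith [sq_nonneg z])

theorem abs_stdNormalCDF_mul_sub_le {a : ℝ} (ha : 1 / 2 ≤ a) (x : ℝ) :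
    |stdNormalCDF (a * x) - stdNormalCDF x| ≤ 2 * |a - 1| := by
  have hd : ∀ z, HasDerivAt (fun b => stdNormalCDF (b * x))
      (exp (-(z * x) ^ 2 / 2) / √(2 * π) * (1 * x)) z := fun z =>
    (hasDerivAt_stdNormalCDF (z * x)).comp (h := fun b => b * x) z
      ((hasDerivAt_id' z).mul_const x)
  have := Convex.norm_image_sub_le_of_norm_hasDerivWithin_le (f := fun b => stdNormalCDF (b * x))
    (s := Set.Ici (1 / 2)) (C := 2) (x := 1) (y := a)
    (fun z _ => (hd z).hasDerivWithinAt) (fun z hz => ?_) (convex_Ici _)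
    (by simp; norm_num) ha
  · simpa using this
  · have hz : 1 / 2 ≤ z := hz
    have h1 := one_le_sqrt_two_pi
    rw [norm_mul, norm_of_nonneg (by positivity : (0 : ℝ) ≤ exp (-(z * x) ^ 2 / 2) / √(2 * π)),
      norm_eq_abs, one_mul]
    have h2 : |z * x| * exp (-(z * x) ^ 2 / 2) ≤ 1 := by
      have e1 := add_one_le_exp ((z * x) ^ 2 / 2)
      have e2 : |z * x| ≤ exp ((z * x) ^ 2 / 2) := by
        nlinarith [sq_abs (z * x), sq_nonneg (|z * x| - 1)]
      calc _ ≤ exp ((z * x) ^ 2 / 2) * exp (-(z * x) ^ 2 / 2) := by gcongr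
        _ = 1 := by rw [← exp_add]; simp [neg_div]
    rw [div_mul_eq_mul_div, div_le_iff₀ sqrt_two_pi_pos]
    rw [abs_mul, abs_of_nonneg (by linarith : 0 ≤ z)] at h2
    have h3 : 0 ≤ exp (-(z * x) ^ 2 / 2) * |x| := by positivity
    nlinarith

/-- The function `w ↦ e^{w²/2} ∫_{-∞}^w e^{-t²/2} dt`. -/
noncomputable def mills (w : ℝ) : ℝ := exp (w ^ 2 / 2) * gaussInt w

theorem mills_nonneg (w : ℝ) : 0 ≤ mills w := mul_nonneg (exp_pos _).le (gaussInt_nonneg w)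

theorem hasDerivAt_mills (w : ℝ) : HasDerivAt mills (w * mills w + 1) w := by
  have h1 : HasDerivAt (fun w : ℝ => exp (w ^ 2 / 2)) (w * exp (w ^ 2 / 2)) w := by
    have := ((hasDerivAt_pow 2 w).div_const 2).exp
    exact this.congr_deriv (by simp; ring)
  refine (h1.fun_mul (hasDerivAt_gaussInt w)).congr_deriv ?_
  rw [← exp_add, mills]
  simp [neg_div]; ring

theorem mul_mills_add_one_nonneg (w : ℝ) : 0 ≤ w * mills w + 1 := by
  have h := mul_nonneg (exp_pos (w ^ 2 / 2)).le (exp_add_mul_gaussInt_nonneg w)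
  have e : exp (w ^ 2 / 2) * exp (-w ^ 2 / 2) = 1 := by rw [← exp_add]; simp [neg_div]
  rw [mul_add, e] at h
  unfold mills
  linarith

theorem mills_mono : Monotone mills :=
  monotone_of_deriv_nonneg (fun x => (hasDerivAt_mills x).differentiableAt) fun x => by
    rw [(hasDerivAt_mills x).deriv]; exact mul_mills_add_one_nonneg x

theorem mills_mul_one_sub (x : ℝ) :
    mills x * (1 - stdNormalCDF x) = mills (-x) * stdNormalCDF x := by
  rw [← stdNormalCDF_neg, stdNormalCDF_eq, stdNormalCDF_eq, mills, mills, neg_sq]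
  ring

theorem mills_zero_le : mills 0 ≤ 2 := by
  have := gaussInt_add_gaussInt_neg 0
  rw [neg_zero] at this
  have h := sqrt_two_pi_le_four
  simp only [mills]
  norm_num
  linarith

theorem mills_mul_le {w x : ℝ} (h : w ≤ x) : mills w * (1 - stdNormalCDF x) ≤ 2 := by
  have h0 := stdNormalCDF_nonneg x
  have h1 := stdNormalCDF_le_one x
  have hz := mills_zero_le
  refine (mul_le_mul_of_nonneg_right (mills_mono h) (by linarith)).trans ?_
  rcases le_total x 0 with hx | hx
  · have := mills_mono hx
    nlinarith [mills_nonneg x]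
  · rw [mills_mul_one_sub]
    have := mills_mono (show -x ≤ 0 by linarith)
    nlinarith [mills_nonneg (-x)]

theorem mills_deriv_mul_nonneg (w x : ℝ) : 0 ≤ (w * mills w + 1) * (1 - stdNormalCDF x) :=
  mul_nonneg (mul_mills_add_one_nonneg w) (by linarith [stdNormalCDF_le_one x])

theorem mills_deriv_mul_le {w x : ℝ} (h : w ≤ x) :
    (w * mills w + 1) * (1 - stdNormalCDF x) ≤ 1 := by
  have h2 := mul_mills_add_one_nonneg (-w)
  have h3 := stdNormalCDF_mono h
  have h0 := stdNormalCDF_nonneg w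
  calc _ ≤ (w * mills w + 1) * (1 - stdNormalCDF w) :=
        mul_le_mul_of_nonneg_left (by linarith) (mul_mills_add_one_nonneg w)
    _ = w * (mills (-w) * stdNormalCDF w) + (1 - stdNormalCDF w) := by
        rw [← mills_mul_one_sub]; ring
    _ ≤ 1 := by nlinarith

/-- Derivative estimate for one smooth branch of the Stein solution. -/
theorem branch_slope {x a h b : ℝ} (hh : 0 < h) (hh1 : h ≤ 1) (hax : a + h ≤ x)
    (hb : b = a ∨ b = a + h) :
    |(b * mills b + 1) * (1 - stdNormalCDF x) -
      (mills (a + h) * (1 - stdNormalCDF x) - mills a * (1 - stdNormalCDF x)) / h| ≤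
      (3 + |b|) * h := by
  set c := 1 - stdNormalCDF x with hc
  have hd1 : ∀ w, HasDerivAt (fun w => mills w * c) ((w * mills w + 1) * c) w :=
    fun w => (hasDerivAt_mills w).mul_const c
  have hd2 : ∀ w, HasDerivAt (fun w => (w * mills w + 1) * c)
      (mills w * c + w * ((w * mills w + 1) * c)) w := by
    intro w
    have := (((hasDerivAt_id' w).fun_mul (hasDerivAt_mills w)).add_const 1).mul_const c
    exact this.congr_deriv (by ring)
  obtain ⟨ξ, hξ, hξe⟩ := exists_hasDerivAt_eq_slope (fun w => mills w * c)
    (fun w => (w * mills w + 1) * c) (show a < a + h by linarith)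
    (fun w _ => (hd1 w).continuousAt.continuousWithinAt) (fun w _ => hd1 w)
  rw [add_sub_cancel_left] at hξe
  rw [← hξe]
  have hbm : b ∈ Set.Icc a (a + h) := by
    rcases hb with rfl | rfl <;> constructor <;> linarith
  have := Convex.norm_image_sub_le_of_norm_hasDerivWithin_le
    (f := fun w => (w * mills w + 1) * c) (s := Set.Icc a (a + h))
    (C := 3 + |b|) (x := ξ) (y := b) (fun z _ => (hd2 z).hasDerivWithinAt) (fun z hz => ?_)
    (convex_Icc _ _) ⟨hξ.1.le, hξ.2.le⟩ hbm
  · refine this.trans (mul_le_mul_of_nonneg_left ?_ (by positivity))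
    rw [norm_eq_abs, abs_le]
    constructor <;> linarith [hξ.1, hξ.2, hbm.1, hbm.2]
  · have hzx : z ≤ x := hz.2.trans hax
    have e1 := mills_mul_le hzx
    have e2 := mills_deriv_mul_le hzx
    have e3 := mills_deriv_mul_nonneg z x
    have e4 : 0 ≤ mills z * c := mul_nonneg (mills_nonneg z) (by
      linarith [stdNormalCDF_le_one x])
    have e5 : |z| ≤ |b| + 1 := by
      have : |z - b| ≤ 1 := by
        rw [abs_le]; constructor <;> linarith [hz.1, hz.2, hbm.1, hbm.2]
      linarith [abs_sub_abs_le_abs_sub z b]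
    rw [← hc] at e1 e2 e3
    calc _ ≤ |mills z * c| + |z * ((z * mills z + 1) * c)| := abs_add_le _ _
      _ ≤ 2 + |z| * 1 := by
        rw [abs_mul z, abs_of_nonneg e4, abs_of_nonneg e3]
        gcongr
      _ ≤ _ := by linarith

theorem branch_lipschitz {x a b : ℝ} (hab : a ≤ b) (hbx : b ≤ x) :
    |mills b * (1 - stdNormalCDF x) - mills a * (1 - stdNormalCDF x)| ≤ b - a := by
  have := Convex.norm_image_sub_le_of_norm_hasDerivWithin_le
    (f := fun w => mills w * (1 - stdNormalCDF x)) (s := Set.Icc a b)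
    (C := 1) (x := a) (y := b)
    (fun z _ => ((hasDerivAt_mills z).mul_const _).hasDerivWithinAt) (fun z hz => ?_)
    (convex_Icc _ _) ⟨le_rfl, hab⟩ ⟨hab, le_rfl⟩
  · rw [norm_eq_abs, norm_eq_abs, abs_of_nonneg (sub_nonneg.2 hab), one_mul] at this
    exact this
  · rw [norm_of_nonneg (mills_deriv_mul_nonneg z x)]
    exact mills_deriv_mul_le (hz.2.trans hbx)

/-- Bounded solution of the Stein equation for the indicator of `(-∞, x]`. -/
noncomputable def steinSol (x w : ℝ) : ℝ :=
  if w ≤ x then mills w * (1 - stdNormalCDF x) else mills (-w) * stdNormalCDF x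

/-- Value of the derivative of `steinSol x` prescribed by the Stein equation. -/
noncomputable def steinDeriv (x w : ℝ) : ℝ :=
  w * steinSol x w + (if w ≤ x then 1 else 0) - stdNormalCDF x

theorem steinSol_of_le {x w : ℝ} (h : w ≤ x) :
    steinSol x w = mills w * (1 - stdNormalCDF x) := if_pos h

theorem steinSol_of_ge {x w : ℝ} (h : x ≤ w) :
    steinSol x w = mills (-w) * (1 - stdNormalCDF (-x)) := by
  rw [stdNormalCDF_neg, sub_sub_cancel]
  rcases h.eq_or_lt with rfl | h
  · rw [steinSol_of_le le_rfl, mills_mul_one_sub]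
  · exact if_neg h.not_ge

theorem steinDeriv_of_le {x w : ℝ} (h : w ≤ x) :
    steinDeriv x w = (w * mills w + 1) * (1 - stdNormalCDF x) := by
  rw [steinDeriv, steinSol_of_le h, if_pos h]; ring

theorem steinDeriv_of_gt {x w : ℝ} (h : x < w) :
    steinDeriv x w = -((-w * mills (-w) + 1) * (1 - stdNormalCDF (-x))) := by
  rw [steinDeriv, steinSol_of_ge h.le, if_neg h.not_ge, stdNormalCDF_neg]; ring

theorem abs_steinDeriv_le (x w : ℝ) : |steinDeriv x w| ≤ 1 := by
  rcases le_or_gt w x with h | h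
  · rw [steinDeriv_of_le h, abs_of_nonneg (mills_deriv_mul_nonneg w x)]
    exact mills_deriv_mul_le h
  · rw [steinDeriv_of_gt h, abs_neg, abs_of_nonneg (mills_deriv_mul_nonneg (-w) (-x))]
    exact mills_deriv_mul_le (by linarith)

theorem steinDeriv_sub_slope {x a h b : ℝ} (hh : 0 < h) (hh1 : h ≤ 1)
    (hb : b = a ∨ b = a + h) :
    |steinDeriv x b - (steinSol x (a + h) - steinSol x a) / h| ≤
      (3 + |b|) * h + 2 * (if |b - x| ≤ h then 1 else 0) := by
  have hnn : (0 : ℝ) ≤ 2 * (if |b - x| ≤ h then 1 else 0) := by positivity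
  rcases le_or_gt (a + h) x with h1 | h1
  · have hbx : b ≤ x := by rcases hb with rfl | rfl <;> linarith
    rw [steinDeriv_of_le hbx, steinSol_of_le h1, steinSol_of_le (by linarith)]
    linarith [branch_slope hh hh1 h1 hb]
  rcases lt_or_ge x a with h2 | h2
  · have hbx : x < b := by rcases hb with rfl | rfl <;> linarith
    rw [steinDeriv_of_gt hbx, steinSol_of_ge h1.le, steinSol_of_ge h2.le]
    have := branch_slope (x := -x) (a := -(a + h)) (b := -b) hh hh1 (by linarith)
      (by rcases hb with rfl | rfl
          · right; ring
          · left; rfl)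
    rw [show -(a + h) + h = -a by ring, abs_neg b] at this
    rw [← abs_neg] at this
    refine le_trans (le_of_eq ?_) (this.trans (by linarith))
    congr 1; ring
  · have hbx : |b - x| ≤ h := by
      rw [abs_le]; rcases hb with rfl | rfl <;> constructor <;> linarith
    rw [if_pos hbx]
    have e1 := branch_lipschitz h2 le_rfl
    have e2 := branch_lipschitz (x := -x) (a := -(a + h)) (b := -x) (by linarith) le_rfl
    rw [← steinSol_of_le le_rfl, ← steinSol_of_le h2] at e1
    rw [← steinSol_of_ge le_rfl, ← steinSol_of_ge h1.le] at e2
    have e3 : |(steinSol x (a + h) - steinSol x a) / h| ≤ 1 := by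
      rw [abs_div, abs_of_pos hh, div_le_one hh]
      rw [abs_le] at *
      constructor <;> linarith [e1.1, e1.2, e2.1, e2.2]
    have e4 := abs_steinDeriv_le x b
    have e5 : 0 ≤ (3 + |b|) * h := by positivity
    linarith [abs_sub (steinDeriv x b) ((steinSol x (a + h) - steinSol x a) / h)]

end SteinGaussian

open SteinGaussian in
/-- Berry–Esseen bound for sums of independent Bernoulli variables. -/
theorem bernoulliSumExp.berry_esseen {p : ℕ → ℝ} {s : Finset ℕ}
    (hp : ∀ i, 0 ≤ p i ∧ p i ≤ 1) {σ : ℝ} (hσ : 1 ≤ σ)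
    (hσ2 : ∑ i ∈ s, p i * (1 - p i) = σ ^ 2) (x : ℝ) :
    |bernoulliSumExp p s (fun k => if ((k : ℝ) - ∑ i ∈ s, p i) / σ ≤ x then 1 else 0) -
      stdNormalCDF x| ≤ 8 / σ := by
  set μ := ∑ i ∈ s, p i with hμ
  have hσ0 : 0 < σ := by linarith
  set w : ℕ → ℝ := fun k => ((k : ℝ) - μ) / σ with hw
  have hws : ∀ k, w (k + 1) = w k + 1 / σ := by
    intro k; simp only [hw]; push_cast; field_simp; ring
  set G : ℕ → ℝ := fun k => steinDeriv x (w k) with hG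
  set F : ℕ → ℝ := fun k => steinSol x (w k) with hF
  set B : ℕ → ℝ := fun k =>
    (3 + |w k|) * (1 / σ) + 2 * (if |w k - x| ≤ 1 / σ then 1 else 0) with hB
  have hstep : ∀ k, |G k - σ * (F (k + 1) - F k)| ≤ B k ∧
      |G (k + 1) - σ * (F (k + 1) - F k)| ≤ B (k + 1) := by
    intro k
    have e : σ * (F (k + 1) - F k) =
        (steinSol x (w k + 1 / σ) - steinSol x (w k)) / (1 / σ) := by
      simp only [hF, hws]; field_simp
    have h1 : 0 < 1 / σ := by positivity
    have h2 : 1 / σ ≤ 1 := by rw [div_le_one hσ0]; exact hσ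
    rw [e]
    exact ⟨steinDeriv_sub_slope h1 h2 (Or.inl rfl), steinDeriv_sub_slope h1 h2 (Or.inr (hws k))⟩
  have hmain : bernoulliSumExp p s (fun k => if w k ≤ x then 1 else 0) - stdNormalCDF x =
      ∑ i ∈ s, p i * (1 - p i) / σ ^ 2 * (bernoulliSumExp p s G -
        bernoulliSumExp p (s.erase i) (fun k => σ * (F (k + 1) - F k))) := by
    have e1 : bernoulliSumExp p s G = bernoulliSumExp p s (fun k => if w k ≤ x then 1 else 0) -
        stdNormalCDF x + bernoulliSumExp p s (fun k => w k * F k) := by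
      rw [← const (p := p) (s := s) (stdNormalCDF x), ← sub, ← add]
      congr 1; funext k
      simp only [hG, hF, steinDeriv]
      ring
    have e2 : bernoulliSumExp p s (fun k => w k * F k) = ∑ i ∈ s, p i * (1 - p i) / σ ^ 2 *
        bernoulliSumExp p (s.erase i) (fun k => σ * (F (k + 1) - F k)) := by
      have : (fun k => w k * F k) = fun k : ℕ => 1 / σ * (((k : ℝ) - μ) * F k) := by
        funext k; simp only [hw]; ring
      rw [this, const_mul, stein_identity, Finset.mul_sum]
      refine Finset.sum_congr rfl fun i _ => ?_
      rw [const_mul]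
      field_simp
    rw [Finset.sum_congr rfl fun i _ => mul_sub (p i * (1 - p i) / σ ^ 2) _ _,
      Finset.sum_sub_distrib, ← e2, ← Finset.sum_mul, ← Finset.sum_div, hσ2, div_self (by positivity), one_mul, e1]
    ring
  have hEB : bernoulliSumExp p s B ≤ 8 / σ := by
    have e : B = fun k : ℕ => 3 / σ + (1 / σ * (1 / σ) * |(k : ℝ) - μ| +
        2 * (if |(k : ℝ) - (μ + σ * x)| ≤ 1 then 1 else 0)) := by
      funext k
      have h1 : |w k - x| ≤ 1 / σ ↔ |(k : ℝ) - (μ + σ * x)| ≤ 1 := by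
        have : (k : ℝ) - (μ + σ * x) = σ * (w k - x) := by
          simp only [hw]; field_simp; ring
        rw [this, abs_mul, abs_of_pos hσ0, le_div_iff₀ hσ0, mul_comm]
      have h2 : |w k| = 1 / σ * |(k : ℝ) - μ| := by
        simp only [hw]; rw [abs_div, abs_of_pos hσ0]; ring
      simp only [hB, h1, h2]
      ring
    rw [e, add, add, const, const_mul, const_mul]
    have a1 := abs_sub_mean_le hp hσ0 hσ2
    have a2 := concentration hp hσ0 hσ2 (μ + σ * x)
    rw [← hμ] at a1
    have a3 : 1 / σ * (1 / σ) * bernoulliSumExp p s (fun k => |(k : ℝ) - μ|) ≤ 1 / σ := by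
      calc _ ≤ 1 / σ * (1 / σ) * σ := by gcongr
        _ = _ := by field_simp
    have : 8 / σ = 3 / σ + (1 / σ + 2 * (2 / σ)) := by ring
    rw [this]
    linarith
  change |bernoulliSumExp p s (fun k => if w k ≤ x then 1 else 0) - stdNormalCDF x| ≤ _
  rw [hmain]
  refine (Finset.abs_sum_le_sum_abs _ _).trans (le_trans ?_ hEB)
  have hwt : ∀ i, 0 ≤ p i * (1 - p i) / σ ^ 2 := fun i =>
    div_nonneg (mul_nonneg (hp i).1 (by linarith [(hp i).2])) (by positivity)
  calc _ ≤ ∑ i ∈ s, p i * (1 - p i) / σ ^ 2 * bernoulliSumExp p s B := by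
        refine Finset.sum_le_sum fun i hi => ?_
        rw [abs_mul, abs_of_nonneg (hwt i)]
        refine mul_le_mul_of_nonneg_left ?_ (hwt i)
        rw [eq_erase hi G, eq_erase hi B, ← const_mul, ← const_mul, ← add, ← sub,
          ← const_mul, ← const_mul, ← add]
        refine abs_le hp fun k => ?_
        have hp0 := (hp i).1
        have hp1 : 0 ≤ 1 - p i := by linarith [(hp i).2]
        calc _ = |p i * (G (k + 1) - σ * (F (k + 1) - F k)) +
              (1 - p i) * (G k - σ * (F (k + 1) - F k))| := by congr 1; ring
          _ ≤ _ := by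
            refine (abs_add_le _ _).trans ?_
            rw [abs_mul, abs_mul, abs_of_nonneg hp0, abs_of_nonneg hp1]
            gcongr
            · exact (hstep k).2
            · exact (hstep k).1
    _ = _ := by
      rw [← Finset.sum_mul, ← Finset.sum_div, hσ2, div_self (by positivity), one_mul]

/-- Number of records (entries larger than every later entry) of a permutation of `Fin n`. -/
def Equiv.Perm.recordCount {n : ℕ} (τ : Equiv.Perm (Fin n)) : ℕ :=
  (Finset.univ.filter fun k => ∀ k', k < k' → τ k' < τ k).card

/-- The permutation of `Fin (n + 1)` with first entry `a` and remaining entries ordered as `e`. -/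
def Equiv.Perm.consPerm {n : ℕ} (a : Fin (n + 1)) (e : Equiv.Perm (Fin n)) :
    Equiv.Perm (Fin (n + 1)) :=
  ((finSuccEquiv' 0).trans e.optionCongr).trans (finSuccEquiv' a).symm

namespace Equiv.Perm

theorem consPerm_zero {n : ℕ} (a : Fin (n + 1)) (e : Equiv.Perm (Fin n)) :
    consPerm a e 0 = a := by
  simp [consPerm]

theorem consPerm_succ {n : ℕ} (a : Fin (n + 1)) (e : Equiv.Perm (Fin n)) (x : Fin n) :
    consPerm a e x.succ = a.succAbove (e x) := by
  have : x.succ = (0 : Fin (n + 1)).succAbove x := by simp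
  simp only [consPerm, Equiv.trans_apply]
  rw [this, finSuccEquiv'_succAbove]
  simp

theorem consPerm_bijective (n : ℕ) :
    Function.Bijective fun q : Fin (n + 1) × Equiv.Perm (Fin n) => consPerm q.1 q.2 := by
  rw [Fintype.bijective_iff_injective_and_card]
  constructor
  · rintro ⟨a, e⟩ ⟨b, f⟩ h
    simp only at h
    have hab : a = b := by rw [← consPerm_zero a e, h, consPerm_zero]
    subst hab
    congr 1
    ext x : 1
    have := congrArg (fun τ : Equiv.Perm (Fin (n + 1)) => τ x.succ) h
    simp only [consPerm_succ] at this
    exact Fin.succAbove_right_injective this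
  · simp [Fintype.card_perm, Nat.factorial_succ]

theorem recordCount_consPerm {n : ℕ} (a : Fin (n + 1)) (e : Equiv.Perm (Fin n)) :
    (consPerm a e).recordCount = e.recordCount + if a = Fin.last n then 1 else 0 := by
  unfold recordCount
  rw [Finset.card_filter, Fin.sum_univ_succ, Finset.card_filter, add_comm]
  congr 1
  · refine Finset.sum_congr rfl fun x _ => if_congr ?_ rfl rfl
    rw [Fin.forall_fin_succ]
    simp [consPerm_succ]
  · refine if_congr ?_ rfl rfl
    rw [Fin.forall_fin_succ]
    simp only [lt_self_iff_false, false_imp_iff, Fin.succ_pos, true_imp_iff, consPerm_succ,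
      consPerm_zero, true_and]
    constructor
    · intro h
      by_contra hne
      obtain ⟨y, hy⟩ := Fin.exists_succAbove_eq (Ne.symm hne)
      obtain ⟨x, rfl⟩ := e.surjective y
      have := h x
      rw [hy] at this
      exact absurd this (Fin.le_last a).not_gt
    · rintro rfl x
      rw [Fin.succAbove_last]
      exact Fin.castSucc_lt_last _

theorem sum_recordCount (n : ℕ) (g : ℕ → ℝ) :
    ∑ τ : Equiv.Perm (Fin n), g τ.recordCount =
      n.factorial * bernoulliSumExp (fun i => 1 / ((i : ℝ) + 1)) (Finset.range n) g := by
  induction n generalizing g with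
  | zero =>
    rw [Finset.range_zero, bernoulliSumExp.empty]
    simp [recordCount]
  | succ n ih =>
    rw [Finset.range_add_one, bernoulliSumExp.insert_eq (by simp),
      ← (consPerm_bijective n).sum_comp fun τ => g τ.recordCount, Fintype.sum_prod_type,
      Fin.sum_univ_castSucc]
    have h1 : ∀ a : Fin n, (∑ e : Equiv.Perm (Fin n), g (consPerm a.castSucc e).recordCount) =
        n.factorial * bernoulliSumExp (fun i => 1 / ((i : ℝ) + 1)) (Finset.range n) g := by
      intro a
      rw [← ih]
      refine Finset.sum_congr rfl fun e _ => ?_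
      rw [recordCount_consPerm, if_neg (Fin.castSucc_lt_last a).ne, add_zero]
    have h2 : (∑ e : Equiv.Perm (Fin n), g (consPerm (Fin.last n) e).recordCount) =
        n.factorial * bernoulliSumExp (fun i => 1 / ((i : ℝ) + 1)) (Finset.range n)
          (fun k => g (k + 1)) := by
      rw [← ih]
      refine Finset.sum_congr rfl fun e _ => ?_
      rw [recordCount_consPerm, if_pos rfl]
    simp only [h1, h2, Finset.sum_const, Finset.card_univ, Fintype.card_fin, nsmul_eq_mul,
      Nat.factorial_succ, Nat.cast_mul]
    push_cast
    have : (n : ℝ) + 1 ≠ 0 := by positivity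
    field_simp
    ring

end Equiv.Perm

section TwoRows

open Classical in
/-- Column actions not strictly dominated in the full `2 × n` game. -/
noncomputable def paretoSet {n : ℕ} (σ : Fin 2 → Equiv.Perm (Fin n)) : Finset (Fin n) :=
  Finset.univ.filter fun j => ¬ ∃ j', ∀ i, σ i j < σ i j'

theorem mem_paretoSet {n : ℕ} {σ : Fin 2 → Equiv.Perm (Fin n)} {j : Fin n} :
    j ∈ paretoSet σ ↔ ¬ ∃ j', ∀ i, σ i j < σ i j' := by
  simp [paretoSet]

theorem card_paretoSet {n : ℕ} (σ : Fin 2 → Equiv.Perm (Fin n)) :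
    (paretoSet σ).card = (σ 1 * (σ 0)⁻¹).recordCount := by
  unfold Equiv.Perm.recordCount
  refine Finset.card_bij (fun j _ => σ 0 j) ?_ ?_ ?_
  · intro j hj
    rw [mem_paretoSet] at hj
    simp only [Finset.mem_filter, Finset.mem_univ, true_and]
    intro k' hk
    by_contra hcon
    apply hj
    refine ⟨(σ 0)⁻¹ k', ?_⟩
    rw [Fin.forall_fin_two]
    refine ⟨by simpa using hk, ?_⟩
    simp only [Equiv.Perm.mul_apply, Equiv.Perm.inv_def, Equiv.symm_apply_apply, not_lt] at hcon
    refine lt_of_le_of_ne hcon fun h => ?_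
    have := (σ 1).injective h
    rw [this] at hk
    simp at hk
  · intro a _ b _ h
    exact (σ 0).injective h
  · intro k hk
    simp only [Finset.mem_filter, Finset.mem_univ, true_and] at hk
    refine ⟨(σ 0)⁻¹ k, ?_, by simp⟩
    rw [mem_paretoSet]
    rintro ⟨j', hj'⟩
    have h0 := hj' 0
    have h1 := hj' 1
    simp only [Equiv.Perm.inv_def, Equiv.apply_symm_apply] at h0
    have := hk _ h0
    simp only [Equiv.Perm.mul_apply, Equiv.Perm.inv_def, Equiv.symm_apply_apply] at this
    exact absurd h1 this.not_gt

theorem sum_card_paretoSet (n : ℕ) (g : ℕ → ℝ) :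
    ∑ σ : Fin 2 → Equiv.Perm (Fin n), g (paretoSet σ).card =
      (n.factorial : ℝ) ^ 2 *
        bernoulliSumExp (fun i => 1 / ((i : ℝ) + 1)) (Finset.range n) g := by
  simp only [card_paretoSet]
  rw [← (piFinTwoEquiv fun _ => Equiv.Perm (Fin n)).symm.sum_comp, Fintype.sum_prod_type]
  have : ∀ a : Equiv.Perm (Fin n),
      (∑ b : Equiv.Perm (Fin n), g (b * a⁻¹).recordCount) =
        n.factorial * bernoulliSumExp (fun i => 1 / ((i : ℝ) + 1)) (Finset.range n) g := by
    intro a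
    rw [← Equiv.Perm.sum_recordCount]
    exact Equiv.sum_comp (Equiv.mulRight a⁻¹) fun τ : Equiv.Perm (Fin n) => g τ.recordCount
  simp only [piFinTwoEquiv_symm_apply, Fin.cons_zero, Fin.cons_one]
  rw [Finset.sum_congr rfl fun a _ => this a]
  simp [Fintype.card_perm]
  ring

theorem paretoSet_nonempty {n : ℕ} (hn : 0 < n) (σ : Fin 2 → Equiv.Perm (Fin n)) :
    (paretoSet σ).Nonempty := by
  have : Nonempty (Fin n) := ⟨⟨0, hn⟩⟩
  obtain ⟨j, hj⟩ := Finite.exists_max (σ 0)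
  refine ⟨j, ?_⟩
  rw [mem_paretoSet]
  rintro ⟨j', hj'⟩
  exact absurd (hj' 0) (hj j').not_gt

end TwoRows

section Survivors

variable {n : ℕ} {ω : Omega 2 n}

theorem colDomIn_univ_iff (j : Fin n) :
    ColDomIn (CPay ω) Finset.univ Finset.univ j ↔ j ∉ paretoSet ω.2 := by
  rw [mem_paretoSet, not_not]
  simp [ColDomIn, CPay]

theorem exists_perm_two_eq (i i' : Fin 2) :
    ∃ a : Equiv.Perm (Fin 2), ∀ π : Equiv.Perm (Fin 2), π i < π i' → π = a := by
  revert i i'; decide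

theorem exists_const_of_rowDomIn {X : Finset (Fin 2)} {Y : Finset (Fin n)}
    (hY : paretoSet ω.2 ⊆ Y) {i : Fin 2} (h : RowDomIn (RPay ω) X Y i) :
    ∃ a, ∀ j ∈ paretoSet ω.2, ω.1 j = a := by
  obtain ⟨i', _, h⟩ := h
  obtain ⟨a, ha⟩ := exists_perm_two_eq i i'
  refine ⟨a, fun j hj => ha _ ?_⟩
  simpa [RPay] using h j (hY hj)

theorem SC_of_not_const (h : ¬ ∃ a, ∀ j ∈ paretoSet ω.2, ω.1 j = a) :
    SC ω = (paretoSet ω.2).card := by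
  have h1 : elimStep (RPay ω) (CPay ω) (Finset.univ, Finset.univ) =
      (Finset.univ, paretoSet ω.2) := by
    ext j
    · simp only [elimStep, Finset.mem_filter, Finset.mem_univ, true_and, iff_true]
      exact fun hd => h (exists_const_of_rowDomIn (Finset.subset_univ _) hd)
    · simp [elimStep, colDomIn_univ_iff]
  have h2 : elimStep (RPay ω) (CPay ω) (Finset.univ, paretoSet ω.2) =
      (Finset.univ, paretoSet ω.2) := by
    ext j
    · simp only [elimStep, Finset.mem_filter, Finset.mem_univ, true_and, iff_true]
      exact fun hd => h (exists_const_of_rowDomIn subset_rfl hd)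
    · simp only [elimStep, Finset.mem_filter, and_iff_left_iff_imp]
      rintro hj ⟨j', _, hj'⟩
      exact (colDomIn_univ_iff j).1 ⟨j', Finset.mem_univ _, hj'⟩ hj
  unfold SC survivors survivorsFrom
  rw [add_comm, show n + 2 = (n + 1) + 1 from rfl, Function.iterate_succ_apply, h1,
    Function.iterate_fixed h2]

theorem not_rowDomIn_of_const {a : Equiv.Perm (Fin 2)} {X : Finset (Fin 2)} {Y : Finset (Fin n)}
    {j : Fin n} (hj : j ∈ Y) (hja : ω.1 j = a) : ¬ RowDomIn (RPay ω) X Y (a.symm 1) := by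
  rintro ⟨i', _, h⟩
  have := h j hj
  simp only [RPay, hja, Equiv.apply_symm_apply, Nat.cast_lt] at this
  have h2 := (a i').isLt
  simp at this
  omega

theorem rowDomIn_of_const {a : Equiv.Perm (Fin 2)} {X : Finset (Fin 2)} {Y : Finset (Fin n)}
    (hX : a.symm 1 ∈ X) (hY : ∀ j ∈ Y, ω.1 j = a) {i : Fin 2} (hi : i ≠ a.symm 1) :
    RowDomIn (RPay ω) X Y i := by
  refine ⟨_, hX, fun j hj => ?_⟩
  simp only [RPay, hY j hj, Equiv.apply_symm_apply, Nat.cast_lt]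
  have h1 : a i ≠ 1 := fun h => hi (by rw [← h, Equiv.symm_apply_apply])
  have h2 : a i < 1 := lt_of_le_of_ne (by omega) h1
  exact h2

theorem elimStep_fst_of_const {a : Equiv.Perm (Fin 2)} {X : Finset (Fin 2)} {Y : Finset (Fin n)}
    (hX : a.symm 1 ∈ X) (hY : ∀ j ∈ Y, ω.1 j = a) (hne : Y.Nonempty) :
    (elimStep (RPay ω) (CPay ω) (X, Y)).1 = {a.symm 1} := by
  ext i
  simp only [elimStep, Finset.mem_filter, Finset.mem_singleton]
  constructor
  · rintro ⟨_, h⟩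
    by_contra hi
    exact h (rowDomIn_of_const hX hY hi)
  · rintro rfl
    obtain ⟨j, hj⟩ := hne
    exact ⟨hX, not_rowDomIn_of_const hj (hY j hj)⟩

theorem elimStep_snd_nonempty {X : Finset (Fin 2)} {Y : Finset (Fin n)} (hX : X.Nonempty)
    (hne : Y.Nonempty) : (elimStep (RPay ω) (CPay ω) (X, Y)).2.Nonempty := by
  obtain ⟨i, hi⟩ := hX
  obtain ⟨j, hj, hmax⟩ := Y.exists_max_image (CPay ω i) hne
  refine ⟨j, ?_⟩
  simp only [elimStep, Finset.mem_filter]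
  refine ⟨hj, ?_⟩
  rintro ⟨j', hj', h⟩
  exact absurd (h i hi) (hmax j' hj').not_gt

theorem elimStep_snd_singleton {i : Fin 2} {Y : Finset (Fin n)} (hne : Y.Nonempty) :
    ∃ j ∈ Y, (elimStep (RPay ω) (CPay ω) ({i}, Y)).2 = {j} := by
  obtain ⟨j, hj, hmax⟩ := Y.exists_max_image (CPay ω i) hne
  refine ⟨j, hj, ?_⟩
  ext k
  simp only [elimStep, Finset.mem_filter, Finset.mem_singleton, ColDomIn, forall_eq]
  constructor
  · rintro ⟨hk, h⟩
    by_contra hkj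
    refine h ⟨j, hj, lt_of_le_of_ne (hmax k hk) fun he => hkj ?_⟩
    simp only [CPay, Nat.cast_inj] at he
    exact (ω.2 i).injective (Fin.ext he)
  · rintro rfl
    refine ⟨hj, ?_⟩
    rintro ⟨j', hj', h⟩
    exact absurd h (hmax j' hj').not_gt

theorem SC_of_const (hn : 0 < n) (h : ∃ a, ∀ j ∈ paretoSet ω.2, ω.1 j = a) : SC ω = 1 := by
  obtain ⟨a, ha⟩ := h
  obtain ⟨m, rfl⟩ : ∃ m, n = m + 1 := ⟨n - 1, by omega⟩
  have hP := paretoSet_nonempty hn ω.2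
  set step := elimStep (RPay ω) (CPay ω) with hstep
  obtain ⟨X₁, h1, hX₁⟩ : ∃ X₁, step (Finset.univ, Finset.univ) = (X₁, paretoSet ω.2) ∧
      a.symm 1 ∈ X₁ := by
    refine ⟨(step (Finset.univ, Finset.univ)).1, Prod.ext rfl ?_, ?_⟩
    · ext j
      simp [hstep, elimStep, colDomIn_univ_iff]
    · obtain ⟨j, hj⟩ := hP
      simp only [hstep, elimStep, Finset.mem_filter, Finset.mem_univ, true_and]
      exact not_rowDomIn_of_const (Finset.mem_univ j) (ha j hj)
  obtain ⟨Y₂, h2, hY₂, hne₂⟩ : ∃ Y₂, step (X₁, paretoSet ω.2) = ({a.symm 1}, Y₂) ∧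
      Y₂ ⊆ paretoSet ω.2 ∧ Y₂.Nonempty := by
    refine ⟨_, Prod.ext (elimStep_fst_of_const hX₁ ha hP) rfl, fun j hj => ?_,
      elimStep_snd_nonempty ⟨_, hX₁⟩ hP⟩
    simp only [hstep, elimStep, Finset.mem_filter] at hj
    exact hj.1
  have h3 : ∀ Y : Finset (Fin (m + 1)), Y ⊆ paretoSet ω.2 → Y.Nonempty →
      ∃ j ∈ Y, step ({a.symm 1}, Y) = ({a.symm 1}, {j}) := by
    intro Y hY hne
    obtain ⟨j, hj, h⟩ := elimStep_snd_singleton (ω := ω) (i := a.symm 1) hne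
    exact ⟨j, hj, Prod.ext
      (elimStep_fst_of_const (Finset.mem_singleton_self _) (fun j hj => ha j (hY hj)) hne) h⟩
  obtain ⟨j, hj, h4⟩ := h3 Y₂ hY₂ hne₂
  obtain ⟨j', hj', h5⟩ := h3 {j} (Finset.singleton_subset_iff.2 (hY₂ hj))
    (Finset.singleton_nonempty j)
  rw [Finset.mem_singleton] at hj'
  rw [hj'] at h5
  unfold SC survivors survivorsFrom
  rw [← hstep, show 2 + (m + 1) = m + 1 + 1 + 1 by ring, Function.iterate_succ_apply, h1,
    Function.iterate_succ_apply, h2, Function.iterate_succ_apply, h4, Function.iterate_fixed h5]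
  exact Finset.card_singleton j

theorem card_const_on (P : Finset (Fin n)) (a : Equiv.Perm (Fin 2)) :
    (∑ c : Fin n → Equiv.Perm (Fin 2), if ∀ j ∈ P, c j = a then (1 : ℝ) else 0) =
      2 ^ n * (1 / 2) ^ P.card := by
  have h : (Finset.univ.filter fun c : Fin n → Equiv.Perm (Fin 2) => ∀ j ∈ P, c j = a) =
      Fintype.piFinset fun j => if j ∈ P then {a} else Finset.univ := by
    ext c
    simp only [Finset.mem_filter, Finset.mem_univ, true_and, Fintype.mem_piFinset]
    refine forall_congr' fun j => ?_
    split_ifs with hj <;> simp [hj]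
  rw [Finset.sum_boole, h, Fintype.card_piFinset, Nat.cast_prod]
  have h2 : ∀ j : Fin n, (((if j ∈ P then {a} else Finset.univ :
      Finset (Equiv.Perm (Fin 2))).card : ℕ) : ℝ) = 2 * if j ∈ P then 1 / 2 else 1 := by
    intro j
    split_ifs <;> simp [Fintype.card_perm]
  rw [Finset.prod_congr rfl fun j _ => h2 j, Finset.prod_mul_distrib, Finset.prod_ite_mem]
  simp

theorem sum_const_on {P : Finset (Fin n)} (hP : P.Nonempty) :
    (∑ c : Fin n → Equiv.Perm (Fin 2), if ∃ a, ∀ j ∈ P, c j = a then (1 : ℝ) else 0) =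
      2 ^ n * (2 * (1 / 2) ^ P.card) := by
  have h : ∀ c : Fin n → Equiv.Perm (Fin 2),
      (if ∃ a, ∀ j ∈ P, c j = a then (1 : ℝ) else 0) =
        ∑ a, if ∀ j ∈ P, c j = a then (1 : ℝ) else 0 := by
    intro c
    obtain ⟨j₀, hj₀⟩ := hP
    split_ifs with hc
    · obtain ⟨a, ha⟩ := hc
      rw [Finset.sum_eq_single a, if_pos ha]
      · exact fun b _ hb => if_neg fun h => hb ((h j₀ hj₀).symm.trans (ha j₀ hj₀))
      · simp
    · symm
      exact Finset.sum_eq_zero fun a _ => if_neg fun h => hc ⟨a, h⟩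
  rw [Finset.sum_congr rfl fun c _ => h c, Finset.sum_comm,
    Finset.sum_congr rfl fun a _ => card_const_on P a]
  simp [Fintype.card_perm]
  ring

/-- The law of the number of surviving Column actions, as a mixture built from a sum of independent
Bernoulli variables. -/
theorem average_SC {n : ℕ} (hn : 0 < n) (F : ℕ → ℝ) :
    (∑ ω : Omega 2 n, F (SC ω)) / (Fintype.card (Omega 2 n) : ℝ) =
      bernoulliSumExp (fun i => 1 / ((i : ℝ) + 1)) (Finset.range n)
        (fun k => F k + 2 * (1 / 2) ^ k * (F 1 - F k)) := by
  have hSC : ∀ ω : Omega 2 n, F (SC ω) = F (paretoSet ω.2).card +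
      (if ∃ a, ∀ j ∈ paretoSet ω.2, ω.1 j = a then (1 : ℝ) else 0) *
        (F 1 - F (paretoSet ω.2).card) := by
    intro ω
    split_ifs with h
    · rw [SC_of_const hn h]; ring
    · rw [SC_of_not_const h]; ring
  have hsum : ∑ ω : Omega 2 n, F (SC ω) = 2 ^ n * ((n.factorial : ℝ) ^ 2 *
      bernoulliSumExp (fun i => 1 / ((i : ℝ) + 1)) (Finset.range n)
        (fun k => F k + 2 * (1 / 2) ^ k * (F 1 - F k))) := by
    rw [← sum_card_paretoSet, Finset.sum_congr rfl fun ω _ => hSC ω, Fintype.sum_prod_type_right,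
      Finset.mul_sum]
    refine Finset.sum_congr rfl fun σ _ => ?_
    simp only
    rw [Finset.sum_add_distrib, ← Finset.sum_mul, sum_const_on (paretoSet_nonempty hn σ)]
    simp [Fintype.card_perm]
    ring
  rw [hsum]
  have hcard : (Fintype.card (Omega 2 n) : ℝ) = 2 ^ n * (n.factorial : ℝ) ^ 2 := by
    simp [Omega, Fintype.card_perm]
  have h0 : (n.factorial : ℝ) ≠ 0 := by positivity
  rw [hcard]
  field_simp

end Survivors

section Asymptotics

open Real Topology

/-- Mean of the number of records of a uniform permutation of `n` elements. -/
noncomputable def recMean (n : ℕ) : ℝ := ∑ i ∈ Finset.range n, 1 / ((i : ℝ) + 1)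

/-- Variance of the number of records of a uniform permutation of `n` elements. -/
noncomputable def recVar (n : ℕ) : ℝ :=
  ∑ i ∈ Finset.range n, 1 / ((i : ℝ) + 1) * (1 - 1 / ((i : ℝ) + 1))

/-- Expectation of a function of the number of records of a uniform permutation. -/
noncomputable def recExp (n : ℕ) (g : ℕ → ℝ) : ℝ :=
  bernoulliSumExp (fun i => 1 / ((i : ℝ) + 1)) (Finset.range n) g

theorem recProb_mem (i : ℕ) : 0 ≤ 1 / ((i : ℝ) + 1) ∧ 1 / ((i : ℝ) + 1) ≤ 1 := by
  refine ⟨by positivity, ?_⟩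
  rw [div_le_one (by positivity)]
  linarith [(Nat.cast_nonneg i : (0 : ℝ) ≤ i)]

theorem recMean_eq_harmonic (n : ℕ) : recMean n = (harmonic n : ℝ) := by
  simp [recMean, harmonic]

theorem tendsto_recMean_sub_log :
    Tendsto (fun n : ℕ => recMean n - log n) atTop (𝓝 eulerMascheroniConstant) := by
  simp only [recMean_eq_harmonic]
  exact tendsto_harmonic_sub_log

theorem tendsto_recVar_sub_log :
    Tendsto (fun n : ℕ => recVar n - log n) atTop (𝓝 (eulerMascheroniConstant - π ^ 2 / 6)) := by
  have h : Tendsto (fun n : ℕ => ∑ i ∈ Finset.range n, 1 / ((i : ℝ) + 1) ^ 2) atTop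
      (𝓝 (π ^ 2 / 6)) := by
    have h1 := (hasSum_nat_add_iff' 1).2 hasSum_zeta_two
    simpa using h1.tendsto_sum_nat
  refine (tendsto_recMean_sub_log.sub h).congr fun n => ?_
  have : recVar n = recMean n - ∑ i ∈ Finset.range n, 1 / ((i : ℝ) + 1) ^ 2 := by
    rw [recVar, recMean, ← Finset.sum_sub_distrib]
    refine Finset.sum_congr rfl fun i _ => ?_
    rw [mul_sub, mul_one, div_mul_div_comm, one_mul, sq]
  rw [this]; ring

theorem recExp_three_quarters_pow_le (n : ℕ) :
    recExp n (fun k => (3 / 4 : ℝ) ^ k) ≤ exp (-log n / 4) := by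
  rw [recExp, bernoulliSumExp.pow]
  calc _ ≤ ∏ i ∈ Finset.range n, exp (-(1 / 4) * (1 / ((i : ℝ) + 1))) := by
        refine Finset.prod_le_prod (fun i _ => ?_) fun i _ => ?_
        · linarith [recProb_mem i]
        · have := add_one_le_exp (-(1 / 4) * (1 / ((i : ℝ) + 1)))
          linarith
    _ = exp (-(1 / 4) * recMean n) := by
        rw [← exp_sum, recMean, Finset.mul_sum]
    _ ≤ _ := by
        rw [exp_le_exp, recMean_eq_harmonic]
        rcases Nat.eq_zero_or_pos n with rfl | hn
        · simp
        have h1 := log_add_one_le_harmonic n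
        have h2 : log n ≤ log ((n + 1 : ℕ) : ℝ) :=
          log_le_log (by exact_mod_cast hn) (by push_cast; linarith)
        linarith

theorem sq_mul_half_pow_le (k : ℕ) : (k : ℝ) ^ 2 * (1 / 2) ^ k ≤ 8 * (3 / 4) ^ k := by
  have h : (k : ℝ) ^ 2 ≤ 8 * (3 / 2) ^ k := by
    rcases lt_or_ge k 5 with hk | hk
    · interval_cases k <;> norm_num
    · induction k, hk using Nat.le_induction with
      | base => norm_num
      | succ k hk ih =>
        have : (5 : ℝ) ≤ k := by exact_mod_cast hk
        rw [pow_succ (3 / 2 : ℝ) k]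
        push_cast
        nlinarith
  calc _ ≤ 8 * (3 / 2 : ℝ) ^ k * (1 / 2) ^ k := by gcongr
    _ = _ := by rw [mul_assoc, ← mul_pow]; norm_num

theorem one_add_sq_mul_half_pow_le (k : ℕ) :
    2 * (1 / 2 : ℝ) ^ k * (1 + (k : ℝ) ^ 2) ≤ 18 * (3 / 4) ^ k := by
  have h1 := sq_mul_half_pow_le k
  have h2 : (1 / 2 : ℝ) ^ k ≤ (3 / 4) ^ k :=
      pow_le_pow_left₀ (by norm_num) (by norm_num) k
  linarith

theorem abs_recExp_le {n : ℕ} {g : ℕ → ℝ} {c : ℝ} (hc : 0 ≤ c)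
    (hg : ∀ k, |g k| ≤ c * (3 / 4) ^ k) : |recExp n g| ≤ c * exp (-log n / 4) := by
  refine (bernoulliSumExp.abs_le recProb_mem hg).trans ?_
  rw [bernoulliSumExp.const_mul]
  exact mul_le_mul_of_nonneg_left (recExp_three_quarters_pow_le n) hc

theorem abs_muSC_sub_recMean_le {n : ℕ} (hn : 0 < n) :
    |muSC n - recMean n| ≤ 18 * exp (-log n / 4) := by
  have h := average_SC hn fun k => (k : ℝ)
  change muSC n = _ at h
  rw [bernoulliSumExp.add, bernoulliSumExp.mean] at h
  rw [h, recMean, add_sub_cancel_left]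
  refine abs_recExp_le (by norm_num) fun k => ?_
  rw [abs_mul, abs_of_nonneg (by positivity : (0 : ℝ) ≤ 2 * (1 / 2) ^ k)]
  refine le_trans (mul_le_mul_of_nonneg_left ?_ (by positivity)) (one_add_sq_mul_half_pow_le k)
  rw [abs_le]
  push_cast
  constructor <;> nlinarith [sq_nonneg ((k : ℝ) - 1), (Nat.cast_nonneg k : (0 : ℝ) ≤ k)]

theorem abs_varSC_sub_recVar_le {n : ℕ} (hn : 0 < n) :
    |varSC n - recVar n| ≤ (18 * exp (-log n / 4)) ^ 2 +
      (1 + 2 * |muSC n|) * 18 * exp (-log n / 4) := by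
  have h := average_SC hn fun k => ((k : ℝ) - muSC n) ^ 2
  change varSC n = _ at h
  have h1 : (fun k : ℕ => ((k : ℝ) - muSC n) ^ 2) = fun k : ℕ =>
      ((k : ℝ) - recMean n) ^ 2 + (2 * (recMean n - muSC n) * ((k : ℝ) - recMean n) +
        (recMean n - muSC n) ^ 2) := by
    funext k; ring
  have h2 : bernoulliSumExp (fun i => 1 / ((i : ℝ) + 1)) (Finset.range n)
      (fun k : ℕ => ((k : ℝ) - muSC n) ^ 2) = recVar n + (muSC n - recMean n) ^ 2 := by
    rw [h1, bernoulliSumExp.add, bernoulliSumExp.add, bernoulliSumExp.const,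
      bernoulliSumExp.const_mul, bernoulliSumExp.sub, bernoulliSumExp.const, bernoulliSumExp.mean]
    have := bernoulliSumExp.variance (p := fun i => 1 / ((i : ℝ) + 1)) (s := Finset.range n)
    change bernoulliSumExp _ _ (fun k : ℕ => ((k : ℝ) - recMean n) ^ 2) = recVar n at this
    rw [this]
    change recVar n + (2 * (recMean n - muSC n) * (recMean n - recMean n) + _) = _
    ring
  rw [bernoulliSumExp.add, h2] at h
  have h3 := abs_muSC_sub_recMean_le hn
  have h4 := abs_recExp_le (n := n) (c := (1 + 2 * |muSC n|) * 18) (g := fun k : ℕ =>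
      2 * (1 / 2 : ℝ) ^ k * ((((1 : ℕ) : ℝ) - muSC n) ^ 2 - ((k : ℝ) - muSC n) ^ 2))
    (by positivity) fun k => by
      rw [abs_mul, abs_of_nonneg (by positivity : (0 : ℝ) ≤ 2 * (1 / 2) ^ k), mul_assoc _ 18]
      refine le_trans ?_ (mul_le_mul_of_nonneg_left (one_add_sq_mul_half_pow_le k) (by positivity))
      rw [mul_left_comm]
      refine mul_le_mul_of_nonneg_left ?_ (by positivity)
      have hk : (0 : ℝ) ≤ k := Nat.cast_nonneg k
      have e1 : |1 - (k : ℝ) ^ 2| ≤ 1 + (k : ℝ) ^ 2 := by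
        rw [abs_le]; constructor <;> nlinarith
      have e2 : |1 - (k : ℝ)| ≤ 1 + (k : ℝ) ^ 2 := by
        rw [abs_le]; constructor <;> nlinarith [sq_nonneg ((k : ℝ) - 1)]
      calc _ = |(1 - (k : ℝ) ^ 2) + -(2 * muSC n * (1 - (k : ℝ)))| := by
            congr 1; push_cast; ring
        _ ≤ |1 - (k : ℝ) ^ 2| + 2 * |muSC n| * |1 - (k : ℝ)| := by
            refine (abs_add_le _ _).trans ?_
            rw [abs_neg, abs_mul, abs_mul, abs_two]
        _ ≤ (1 + (k : ℝ) ^ 2) + 2 * |muSC n| * (1 + (k : ℝ) ^ 2) := by gcongr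
        _ = _ := by ring
  rw [h]
  calc _ = |(muSC n - recMean n) ^ 2 + recExp n (fun k : ℕ =>
      2 * (1 / 2 : ℝ) ^ k * ((((1 : ℕ) : ℝ) - muSC n) ^ 2 - ((k : ℝ) - muSC n) ^ 2))| := by
        congr 1; rw [recExp]; ring
    _ ≤ _ := by
        refine (abs_add_le _ _).trans (add_le_add ?_ h4)
        rw [abs_pow]
        gcongr

theorem tendsto_log_natCast : Tendsto (fun n : ℕ => log n) atTop atTop :=
  tendsto_log_atTop.comp tendsto_natCast_atTop_atTop

theorem tendsto_exp_neg_log_div_four :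
    Tendsto (fun n : ℕ => exp (-log n / 4)) atTop (𝓝 0) := by
  refine tendsto_exp_atBot.comp ?_
  exact (tendsto_neg_atTop_atBot.comp tendsto_log_natCast).atBot_div_const (by norm_num)

theorem tendsto_log_mul_exp :
    Tendsto (fun n : ℕ => log n * exp (-log n / 4)) atTop (𝓝 0) := by
  have h := (tendsto_pow_mul_exp_neg_atTop_nhds_zero 1).comp
    (tendsto_log_natCast.atTop_div_const (show (0 : ℝ) < 4 by norm_num))
  have := h.const_mul 4
  rw [mul_zero] at this
  refine this.congr fun n => ?_
  simp only [Function.comp_apply, pow_one, neg_div]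
  ring

theorem tendsto_muSC_sub_recMean : Tendsto (fun n => muSC n - recMean n) atTop (𝓝 0) := by
  have h := tendsto_exp_neg_log_div_four.const_mul 18
  rw [mul_zero] at h
  refine squeeze_zero_norm' ?_ h
  filter_upwards [eventually_gt_atTop 0] with n hn
  exact abs_muSC_sub_recMean_le hn

theorem tendsto_muSC_sub_log :
    Tendsto (fun n : ℕ => muSC n - log n) atTop (𝓝 eulerMascheroniConstant) := by
  have := tendsto_muSC_sub_recMean.add tendsto_recMean_sub_log
  rw [zero_add] at this
  exact this.congr fun n => by ring

theorem tendsto_varSC_sub_recVar : Tendsto (fun n => varSC n - recVar n) atTop (𝓝 0) := by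
  have h0 := tendsto_exp_neg_log_div_four
  have h1 : Tendsto (fun n : ℕ => |muSC n| * exp (-log n / 4)) atTop (𝓝 0) := by
    have h := ((tendsto_muSC_sub_log.mul h0).add tendsto_log_mul_exp).abs
    rw [mul_zero, add_zero, abs_zero] at h
    refine h.congr fun n => ?_
    rw [← add_mul, sub_add_cancel, abs_mul, abs_exp]
  have h := (((h0.const_mul 18).pow 2).add (h0.const_mul 18)).add (h1.const_mul 36)
  simp only [mul_zero, add_zero, ne_eq, OfNat.ofNat_ne_zero, not_false_eq_true, zero_pow] at h
  refine squeeze_zero_norm' ?_ h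
  filter_upwards [eventually_gt_atTop 0] with n hn
  refine (abs_varSC_sub_recVar_le hn).trans (le_of_eq ?_)
  ring

theorem tendsto_varSC_sub_log :
    Tendsto (fun n : ℕ => varSC n - log n) atTop (𝓝 (eulerMascheroniConstant - π ^ 2 / 6)) := by
  have := tendsto_varSC_sub_recVar.add tendsto_recVar_sub_log
  rw [zero_add] at this
  exact this.congr fun n => by ring

theorem tendsto_sigmaSC_expansion : Tendsto (fun n : ℕ =>
    (sigmaSC n - (√(log n) - (π ^ 2 - 6 * eulerMascheroniConstant) / (12 * √(log n)))) *
      √(log n)) atTop (𝓝 0) := by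
  have hL := tendsto_log_natCast
  have h1 : Tendsto (fun n : ℕ => √(varSC n / log n)) atTop (𝓝 1) := by
    have h := (tendsto_varSC_sub_log.div_atTop hL).add_const 1
    rw [zero_add] at h
    have h2 := (continuous_sqrt.tendsto 1).comp h
    rw [sqrt_one] at h2
    refine h2.congr' ?_
    filter_upwards [hL.eventually_gt_atTop 0] with n hn
    simp only [Function.comp_apply]
    congr 1
    field_simp
    ring
  have h2 := (tendsto_varSC_sub_log.div (h1.add_const 1) (by norm_num)).sub_const
    ((eulerMascheroniConstant - π ^ 2 / 6) / 2)
  rw [show (eulerMascheroniConstant - π ^ 2 / 6) / (1 + 1) -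
    (eulerMascheroniConstant - π ^ 2 / 6) / 2 = 0 by ring] at h2
  have hv : Tendsto (fun n : ℕ => varSC n) atTop atTop := by
    refine (tendsto_varSC_sub_log.add_atTop hL).congr fun n => by ring
  refine h2.congr' ?_
  filter_upwards [hL.eventually_gt_atTop 0, hv.eventually_gt_atTop 0] with n hn hvn
  have hs : 0 < √(log n) := sqrt_pos.2 hn
  simp only [Pi.div_apply]
  rw [sqrt_div hvn.le, sigmaSC]
  have e1 := sq_sqrt hn.le
  have e2 := sq_sqrt hvn.le
  have e3 : 0 ≤ √(varSC n) := sqrt_nonneg _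
  set a := √(log n)
  set b := √(varSC n)
  rw [← e1, ← e2]
  have : b + a ≠ 0 := by positivity
  field_simp
  ring

open Classical in
theorem Pr_eq_average {m n : ℕ} (S : Set (Omega m n)) :
    Pr S = (∑ ω : Omega m n, if ω ∈ S then (1 : ℝ) else 0) / Fintype.card (Omega m n) := by
  rw [Pr, Finset.sum_boole]
  congr 3
  ext ω; simp

open SteinGaussian in
theorem abs_Pr_sub_stdNormalCDF_le {n : ℕ} (hn : 0 < n) (hL : 0 < log n) (hV4 : 4 ≤ recVar n)
    (hVL : log n / 4 ≤ recVar n) (hv : |varSC n - recVar n| ≤ 1) (x : ℝ) :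
    |Pr {ω : Omega 2 n | (SC ω : ℝ) - muSC n ≤ x * sigmaSC n} - stdNormalCDF x| ≤
      58 / √(log n) := by
  set s := √(recVar n) with hs
  have hs2 : s ^ 2 = recVar n := sq_sqrt (by linarith)
  have hs1 : 2 ≤ s := le_sqrt_of_sq_le (by linarith)
  have hsL : √(log n) / 2 ≤ s := by
    refine le_sqrt_of_sq_le ?_
    rw [div_pow, sq_sqrt hL.le]; linarith
  have hs0 : 0 < s := by linarith
  have hL0 : 0 < √(log n) := sqrt_pos.2 hL
  have hε : exp (-log n / 4) ≤ 1 / √(log n) := by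
    rw [neg_div, exp_neg, ← one_div]
    refine one_div_le_one_div_of_le hL0 ?_
    have h1 := add_one_le_exp (log n / 4)
    have h2 := sq_sqrt hL.le
    nlinarith [sq_nonneg (√(log n) / 2 - 1)]
  have hε1 : exp (-log n / 4) ≤ 1 := exp_le_one_iff.2 (by linarith)
  set F : ℕ → ℝ := fun k => if (k : ℝ) - muSC n ≤ x * sigmaSC n then 1 else 0 with hF
  have hPr : Pr {ω : Omega 2 n | (SC ω : ℝ) - muSC n ≤ x * sigmaSC n} =
      recExp n F + recExp n (fun k => 2 * (1 / 2) ^ k * (F 1 - F k)) := by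
    rw [recExp, recExp, ← bernoulliSumExp.add, ← average_SC hn F, Pr_eq_average]
    simp only [hF, Set.mem_ofPred_eq]
  have herr : |recExp n (fun k => 2 * (1 / 2) ^ k * (F 1 - F k))| ≤ 2 * exp (-log n / 4) := by
    refine abs_recExp_le (by norm_num) fun k => ?_
    rw [abs_mul, abs_of_nonneg (by positivity : (0 : ℝ) ≤ 2 * (1 / 2) ^ k)]
    have h1 : |F 1 - F k| ≤ 1 := by
      simp only [hF]; split_ifs <;> norm_num
    have h2 : (1 / 2 : ℝ) ^ k ≤ (3 / 4) ^ k :=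
      pow_le_pow_left₀ (by norm_num) (by norm_num) k
    nlinarith [abs_nonneg (F 1 - F k), (by positivity : (0 : ℝ) < (1 / 2) ^ k)]
  set y := (muSC n - recMean n + x * sigmaSC n) / s with hy
  have hFy : F = fun k : ℕ =>
      if ((k : ℝ) - ∑ i ∈ Finset.range n, 1 / ((i : ℝ) + 1)) / s ≤ y then 1 else 0 := by
    funext k
    change _ = if ((k : ℝ) - recMean n) / s ≤ y then (1 : ℝ) else 0
    refine if_congr ?_ rfl rfl
    rw [hy, div_le_div_iff_of_pos_right hs0]
    constructor <;> intro h <;> linarith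
  have hBE : |recExp n F - stdNormalCDF y| ≤ 8 / s := by
    rw [hFy]
    exact bernoulliSumExp.berry_esseen recProb_mem (by linarith) hs2.symm y
  set a := sigmaSC n / s with ha
  have ha2 : a ^ 2 = varSC n / recVar n := by
    rw [ha, div_pow, hs2, sigmaSC, sq_sqrt]
    linarith [(abs_le.1 hv).1]
  have ha0 : 0 ≤ a := div_nonneg (sqrt_nonneg _) hs0.le
  have ha21 : |a ^ 2 - 1| ≤ 1 / recVar n := by
    rw [ha2, div_sub_one (by linarith), abs_div, abs_of_pos (by linarith : 0 < recVar n)]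
    gcongr
  have ha1 : |a - 1| ≤ 1 / s := by
    have h1 : |a - 1| ≤ |a ^ 2 - 1| := by
      rw [show a ^ 2 - 1 = (a - 1) * (a + 1) by ring, abs_mul,
        abs_of_nonneg (by linarith : 0 ≤ a + 1)]
      nlinarith [abs_nonneg (a - 1)]
    refine (h1.trans ha21).trans (one_div_le_one_div_of_le hs0 ?_)
    nlinarith
  have hahalf : 1 / 2 ≤ a := by
    have : 1 / s ≤ 1 / 2 := one_div_le_one_div_of_le (by norm_num) hs1
    linarith [(abs_le.1 ha1).1]
  have h1 : |stdNormalCDF y - stdNormalCDF (a * x)| ≤ 18 / s := by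
    refine (abs_stdNormalCDF_sub_le _ _).trans ?_
    have : y - a * x = (muSC n - recMean n) / s := by rw [hy, ha]; ring
    rw [this, abs_div, abs_of_pos hs0]
    gcongr
    linarith [abs_muSC_sub_recMean_le hn]
  have h2 := (abs_stdNormalCDF_mul_sub_le hahalf x).trans
    (mul_le_mul_of_nonneg_left ha1 (by norm_num))
  have h3 : |Pr {ω : Omega 2 n | (SC ω : ℝ) - muSC n ≤ x * sigmaSC n} - stdNormalCDF x| ≤
      28 * (1 / s) + 2 * (1 / √(log n)) := by
    rw [hPr]
    have e8 : 8 / s = 8 * (1 / s) := by ring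
    have e18 : 18 / s = 18 * (1 / s) := by ring
    rw [e8] at hBE
    rw [e18] at h1
    have b := (herr.trans (mul_le_mul_of_nonneg_left hε (by norm_num)))
    rw [abs_le] at *
    constructor <;> linarith [hBE.1, hBE.2, h1.1, h1.2, h2.1, h2.2, b.1, b.2]
  refine h3.trans ?_
  have h4 : 1 / s ≤ 2 * (1 / √(log n)) := by
    rw [mul_one_div, div_le_div_iff₀ hs0 hL0]; linarith
  have : 58 / √(log n) = 58 * (1 / √(log n)) := by ring
  rw [this]; linarith

theorem Pr_nonneg {m n : ℕ} (S : Set (Omega m n)) : 0 ≤ Pr S := by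
  unfold Pr; positivity

theorem Pr_le_one {m n : ℕ} (S : Set (Omega m n)) : Pr S ≤ 1 := by
  unfold Pr
  refine div_le_one_of_le₀ ?_ (by positivity)
  exact_mod_cast Finset.card_le_univ _

theorem exists_berry_esseen_SC : ∃ K : ℝ, 0 < K ∧ ∀ n : ℕ, 2 ≤ n → ∀ x : ℝ,
    |Pr {ω : Omega 2 n | (SC ω : ℝ) - muSC n ≤ x * sigmaSC n} - stdNormalCDF x|
      ≤ K / √(log n) := by
  have hL := tendsto_log_natCast
  have hV : Tendsto recVar atTop atTop :=
    (tendsto_recVar_sub_log.add_atTop hL).congr fun n => by ring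
  have hVL : ∀ᶠ n : ℕ in atTop, log n / 4 ≤ recVar n := by
    have h := tendsto_recVar_sub_log.add_atTop
      (hL.const_mul_atTop (show (0 : ℝ) < 3 / 4 by norm_num))
    filter_upwards [h.eventually_ge_atTop 0] with n hn
    linarith
  have hv : ∀ᶠ n : ℕ in atTop, |varSC n - recVar n| ≤ 1 := by
    have h := tendsto_varSC_sub_recVar.abs
    rw [abs_zero] at h
    exact h.eventually_le_const one_pos
  obtain ⟨N, hN⟩ := eventually_atTop.1 ((eventually_gt_atTop 0).and
    ((hL.eventually_gt_atTop 0).and ((hV.eventually_ge_atTop 4).and (hVL.and hv))))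
  refine ⟨58 + √(log N), by positivity, fun n hn x => ?_⟩
  have hLn : 0 < log n := log_pos (by exact_mod_cast hn)
  have hLs : 0 < √(log n) := sqrt_pos.2 hLn
  rcases le_or_gt N n with h | h
  · obtain ⟨h1, h2, h3, h4, h5⟩ := hN n h
    refine (abs_Pr_sub_stdNormalCDF_le h1 h2 h3 h4 h5 x).trans ?_
    gcongr
    linarith [sqrt_nonneg (log N)]
  · have h1 : √(log n) ≤ √(log N) := by
      gcongr
    rw [le_div_iff₀ hLs]
    set q := Pr {ω : Omega 2 n | (SC ω : ℝ) - muSC n ≤ x * sigmaSC n} with hq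
    have h2 : |q - stdNormalCDF x| ≤ 1 := by
      have a1 := Pr_nonneg {ω : Omega 2 n | (SC ω : ℝ) - muSC n ≤ x * sigmaSC n}
      have a2 := Pr_le_one {ω : Omega 2 n | (SC ω : ℝ) - muSC n ≤ x * sigmaSC n}
      rw [abs_le]
      constructor <;>
        linarith [SteinGaussian.stdNormalCDF_nonneg x, SteinGaussian.stdNormalCDF_le_one x]
    nlinarith

end Asymptotics

/-- Berry–Esseen–type normal approximation for `S^C(2,n)` with error
`O(1/√(ln n))`, together with the asymptotics `μ_n = ln n + γ + o(1)` and
`σ_n = √(ln n) − (π² − 6γ)/(12√(ln n)) + o(1/√(ln n))`. -/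
theorem stmt9 :
    (∃ K : ℝ, 0 < K ∧ ∀ n : ℕ, 2 ≤ n → ∀ x : ℝ,
      |Pr {ω : Omega 2 n | (SC ω : ℝ) - muSC n ≤ x * sigmaSC n} - stdNormalCDF x|
        ≤ K / Real.sqrt (Real.log n)) ∧
    Filter.Tendsto
      (fun n : ℕ => muSC n - Real.log n - Real.eulerMascheroniConstant)
      Filter.atTop (nhds 0) ∧
    Filter.Tendsto
      (fun n : ℕ =>
        (sigmaSC n - (Real.sqrt (Real.log n) -
            (Real.pi ^ 2 - 6 * Real.eulerMascheroniConstant) /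
              (12 * Real.sqrt (Real.log n)))) * Real.sqrt (Real.log n))
      Filter.atTop (nhds 0) := by
  refine ⟨exists_berry_esseen_SC, ?_, tendsto_sigmaSC_expansion⟩
  have := tendsto_muSC_sub_log.sub_const Real.eulerMascheroniConstant
  rwa [sub_self] at this
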